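/- There is a constant C (independent of the formula) such that for every PML formula φ of modal depth at most 1 in which only the modality ⊤ occurs (φ ∈ PML₁^⊤), there exist an MPNN M_φ ∈ M_mean with at most C·(deg(φ)+1) layers and a natural number e ≤ C·(deg(φ)+1) such that M_φ recognises φ over the class of all pointed graphs (G,v) whose focus v is marked by colour p, with certainty c(|V|) = 1/|V|^e. -/

import Mathlib

namespace PMLMPNN

/-- Modalities of Peano modal logic. -/
inductive Modality where
  | id | ein | eout | top
deriving DecidableEq

/-- A normalised integer inequality `∑ i, a i * ∏ (mon i) ≤ b`. -/
structure PeanoIneq (m : ℕ) where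
  K : ℕ
  a : Fin K → ℤ
  mon : Fin K → List (Fin m)
  b : ℤ

/-- Value of a monomial (a list of variables) under an assignment. -/
def monValZ {m : ℕ} (c : Fin m → ℕ) (l : List (Fin m)) : ℤ :=
  (l.map (fun j => (c j : ℤ))).prod

def PeanoIneq.sat {m : ℕ} (t : PeanoIneq m) (c : Fin m → ℕ) : Bool :=
  decide ((∑ i, t.a i * monValZ c (t.mon i)) ≤ t.b)

def PeanoIneq.deg {m : ℕ} (t : PeanoIneq m) : ℕ :=
  Finset.univ.sup (fun i => (t.mon i).length)

/-- Peano formulas: Boolean combinations of normalised inequalities. -/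
inductive PeanoFormula (m : ℕ) where
  | ineq : PeanoIneq m → PeanoFormula m
  | not : PeanoFormula m → PeanoFormula m
  | and : PeanoFormula m → PeanoFormula m → PeanoFormula m

def PeanoFormula.sat {m : ℕ} (c : Fin m → ℕ) : PeanoFormula m → Bool
  | .ineq t => t.sat c
  | .not ψ => ! ψ.sat c
  | .and ψ₁ ψ₂ => ψ₁.sat c && ψ₂.sat c

def PeanoFormula.deg {m : ℕ} : PeanoFormula m → ℕ
  | .ineq t => t.deg
  | .not ψ => ψ.deg
  | .and ψ₁ ψ₂ => max ψ₁.deg ψ₂.deg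

/-- A term is homogeneous if it has no constant part and all its monomials
have the same degree. -/
def PeanoIneq.Homog {m : ℕ} (t : PeanoIneq m) : Prop :=
  t.b = 0 ∧ ∀ i, (t.mon i).length = t.deg

def PeanoFormula.Homog {m : ℕ} : PeanoFormula m → Prop
  | .ineq t => t.Homog
  | .not ψ => ψ.Homog
  | .and ψ₁ ψ₂ => ψ₁.Homog ∧ ψ₂.Homog

/-- The set of monomials occurring in a Peano formula. -/
def PeanoFormula.mons {m : ℕ} : PeanoFormula m → Finset (List (Fin m))
  | .ineq t => Finset.univ.image t.mon
  | .not ψ => ψ.mons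
  | .and ψ₁ ψ₂ => ψ₁.mons ∪ ψ₂.mons

/-- The set of constants occurring in a Peano formula. -/
def PeanoFormula.consts {m : ℕ} : PeanoFormula m → Finset ℤ
  | .ineq t => {t.b}
  | .not ψ => ψ.consts
  | .and ψ₁ ψ₂ => ψ₁.consts ∪ ψ₂.consts

/-- PML formulas over `k` colours (propositions). -/
inductive PML (k : ℕ) where
  | prop : Fin k → PML k
  | not : PML k → PML k
  | and : PML k → PML k → PML k
  | modal : (m : ℕ) → (Fin m → Modality) → PeanoFormula m → (Fin m → PML k) → PML k

def PML.md {k : ℕ} : PML k → ℕ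
  | .prop _ => 0
  | .not φ => φ.md
  | .and φ₁ φ₂ => max φ₁.md φ₂.md
  | .modal _ _ _ φs => 1 + Finset.univ.sup (fun i => (φs i).md)

def PML.deg {k : ℕ} : PML k → ℕ
  | .prop _ => 0
  | .not φ => φ.deg
  | .and φ₁ φ₂ => max φ₁.deg φ₂.deg
  | .modal _ _ ψ φs => max ψ.deg (Finset.univ.sup (fun i => (φs i).deg))

def PML.onlyTop {k : ℕ} : PML k → Prop
  | .prop _ => True
  | .not φ => φ.onlyTop
  | .and φ₁ φ₂ => φ₁.onlyTop ∧ φ₂.onlyTop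
  | .modal _ π _ φs => (∀ i, π i = Modality.top) ∧ (∀ i, (φs i).onlyTop)

def PML.onlyE {k : ℕ} : PML k → Prop
  | .prop _ => True
  | .not φ => φ.onlyE
  | .and φ₁ φ₂ => φ₁.onlyE ∧ φ₂.onlyE
  | .modal _ π _ φs => (∀ i, π i = Modality.ein ∨ π i = Modality.eout) ∧ (∀ i, (φs i).onlyE)

/-- Propositional formulas: no modal subformula at all. -/
def PML.NoModal {k : ℕ} : PML k → Prop
  | .prop _ => True
  | .not φ => φ.NoModal
  | .and φ₁ φ₂ => φ₁.NoModal ∧ φ₂.NoModal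
  | .modal _ _ _ _ => False

/-- Subformula relation. -/
inductive PML.Sub {k : ℕ} : PML k → PML k → Prop where
  | refl (φ : PML k) : PML.Sub φ φ
  | not {χ φ : PML k} : PML.Sub χ φ → PML.Sub χ (.not φ)
  | and_left {χ φ₁ φ₂ : PML k} : PML.Sub χ φ₁ → PML.Sub χ (.and φ₁ φ₂)
  | and_right {χ φ₁ φ₂ : PML k} : PML.Sub χ φ₂ → PML.Sub χ (.and φ₁ φ₂)
  | modal {χ : PML k} {m : ℕ} {π : Fin m → Modality} {ψ : PeanoFormula m}
      {φs : Fin m → PML k} (i : Fin m) :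
      PML.Sub χ (φs i) → PML.Sub χ (.modal m π ψ φs)

/-- Finite directed node-labelled graphs with `k` colours; labels in `{0,1}^k`
are represented by Boolean vectors. -/
structure Graph (k : ℕ) where
  n : ℕ
  E : Finset (Fin n × Fin n)
  L : Fin n → Fin k → Bool

def Graph.neighIn {k : ℕ} (G : Graph k) (v : Fin G.n) : Finset (Fin G.n) :=
  Finset.univ.filter (fun u => (u, v) ∈ G.E)

def Graph.neighOut {k : ℕ} (G : Graph k) (v : Fin G.n) : Finset (Fin G.n) :=
  Finset.univ.filter (fun u => (v, u) ∈ G.E)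

def Graph.Regular {k : ℕ} (G : Graph k) : Prop :=
  ∀ u v : Fin G.n,
    (G.neighIn u).card = (G.neighIn v).card ∧ (G.neighOut u).card = (G.neighOut v).card

/-- `v` is marked by colour `p`. -/
def Graph.MarkedBy {k : ℕ} (G : Graph k) (v : Fin G.n) (p : Fin k) : Prop :=
  ∀ u : Fin G.n, G.L u p = true ↔ u = v

/-- `v` is strongly marked by colour `p`: marked and `v ∈ neigh(v)`. -/
def Graph.StronglyMarkedBy {k : ℕ} (G : Graph k) (v : Fin G.n) (p : Fin k) : Prop :=
  G.MarkedBy v p ∧ (v, v) ∈ G.E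

def Graph.modSem {k : ℕ} (G : Graph k) (v : Fin G.n) : Modality → Finset (Fin G.n)
  | .id => {v}
  | .ein => G.neighIn v
  | .eout => G.neighOut v
  | .top => Finset.univ

/-- Satisfaction of PML formulas on pointed graphs. -/
def PML.sat {k : ℕ} (G : Graph k) : PML k → Fin G.n → Bool
  | .prop i, v => G.L v i
  | .not φ, v => ! PML.sat G φ v
  | .and φ₁ φ₂, v => PML.sat G φ₁ v && PML.sat G φ₂ v
  | .modal _ π ψ φs, v =>
      ψ.sat (fun i => ((G.modSem v (π i)).filter (fun u => PML.sat G (φs i) u = true)).card)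

/-- Feedforward neural networks with ReLU activations and rational weights. -/
inductive FNN : ℕ → ℕ → Type where
  | layer {din dout : ℕ} (w : Fin dout → Fin din → ℚ) (b : Fin dout → ℚ) : FNN din dout
  | comp {d₁ d₂ d₃ : ℕ} : FNN d₁ d₂ → FNN d₂ d₃ → FNN d₁ d₃

def FNN.eval : {din dout : ℕ} → FNN din dout → (Fin din → ℚ) → Fin dout → ℚ
  | _, _, .layer w b, x => fun j => max 0 (b j + ∑ i, w j i * x i)
  | _, _, .comp f g, x => g.eval (f.eval x)

/-- Aggregation functions on finite multisets of vectors. -/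
inductive Agg where
  | mean | sum | max
deriving DecidableEq

noncomputable def Agg.eval {d : ℕ} : Agg → Multiset (Fin d → ℚ) → Fin d → ℚ
  | .mean, s => fun i => (s.map (fun f => f i)).sum / (Multiset.card s : ℚ)
  | .sum, s => fun i => (s.map (fun f => f i)).sum
  | .max, s => fun i => ((s.map (fun f => f i)).toList).foldr Max.max 0

/-- One MPNN layer: a combination function (an FNN applied to the previous
state and the three aggregated messages) together with the choice of the two
local and the global aggregation functions. -/
structure MPNNLayer (din dout : ℕ) where
  comb : FNN (din + din + din + din) dout
  locIn : Agg
  locOut : Agg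
  glob : Agg

noncomputable def MPNNLayer.step {k din dout : ℕ} (l : MPNNLayer din dout) (G : Graph k)
    (x : Fin G.n → Fin din → ℚ) : Fin G.n → Fin dout → ℚ :=
  fun v => l.comb.eval
    (Fin.append (Fin.append (Fin.append (x v)
      (l.locIn.eval ((G.neighIn v).val.map x)))
      (l.locOut.eval ((G.neighOut v).val.map x)))
      (l.glob.eval ((Finset.univ : Finset (Fin G.n)).val.map x)))

/-- A message passing neural network: `L` layers with state dimensions
`dims 0, dims 1, …, dims L`. -/
structure MPNN where
  L : ℕ
  dims : ℕ → ℕ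
  layers : (i : ℕ) → MPNNLayer (dims i) (dims (i + 1))

/-- Initial state: the label of the node (padded with zeros if needed). -/
def Graph.init {k : ℕ} (G : Graph k) (d : ℕ) (v : Fin G.n) : Fin d → ℚ :=
  fun j => if h : (j : ℕ) < k then (if G.L v ⟨j, h⟩ then 1 else 0) else 0

/-- The state `x_v^{(i)}` computed by `M` on `G`. -/
noncomputable def MPNN.state {k : ℕ} (M : MPNN) (G : Graph k) : (i : ℕ) → Fin G.n → Fin (M.dims i) → ℚ
  | 0 => fun v => G.init (M.dims 0) v
  | i + 1 => (M.layers i).step G (M.state G i)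

/-- Last coordinate of a vector. -/
def lastVal {d : ℕ} (x : Fin d → ℚ) : ℚ :=
  if h : 0 < d then x ⟨d - 1, Nat.sub_lt h Nat.one_pos⟩ else 0

/-- The output `M(G,v)_⊥`: the last coordinate of the final state. -/
noncomputable def MPNN.out {k : ℕ} (M : MPNN) (G : Graph k) (v : Fin G.n) : ℚ :=
  lastVal (M.state G M.L v)

/-- All aggregations of `M` belong to the set `A`. -/
def MPNN.UsesAggs (M : MPNN) (A : Set Agg) : Prop :=
  ∀ i < M.L, (M.layers i).locIn ∈ A ∧ (M.layers i).locOut ∈ A ∧ (M.layers i).glob ∈ A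

/-- `M` belongs to the class `M_mean`. -/
def MPNN.IsMean (M : MPNN) : Prop := M.UsesAggs {Agg.mean}

/-- `M` recognises `φ` over the class `Cls` with certainty `c(|V|)`. -/
def Recognises {k : ℕ} (M : MPNN) (φ : PML k)
    (Cls : (G : Graph k) → Fin G.n → Prop) (c : ℕ → ℚ) : Prop :=
  ∀ (G : Graph k) (v : Fin G.n), Cls G v →
    (PML.sat G φ v = true → M.out G v = c G.n) ∧
    (PML.sat G φ v = false → M.out G v = 0)

end PMLMPNN
namespace PMLMPNN

/-- Scalar ReLU expressions over `D` inputs. -/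
inductive Ex (D : ℕ) where
  | lin (b : ℚ) (w : Fin D → ℚ) : Ex D
  | sub (i : Fin D) (e : Ex D) : Ex D
  | conj (i : Fin D) (e₁ e₂ : Ex D) : Ex D

def Ex.eval {D : ℕ} (x : Fin D → ℚ) : Ex D → ℚ
  | .lin b w => max 0 (b + ∑ i, w i * x i)
  | .sub i e => max 0 (x i - e.eval x)
  | .conj i e₁ e₂ => max 0 (e₁.eval x + e₂.eval x - x i)

theorem FNN.eval_nonneg {D d : ℕ} (N : FNN D d) : ∀ x j, 0 ≤ N.eval x j := by
  induction N with
  | layer w b => intro x j; simp [FNN.eval]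
  | comp f g _ ihg => intro x j; exact ihg _ _

theorem fnn_push {D d : ℕ} (N : FNN D d) (b : ℚ) (w : Fin d → ℚ) :
    ∃ N' : FNN D (d + 1), (∀ x j, N'.eval x (Fin.castSucc j) = N.eval x j) ∧
      ∀ x, N'.eval x (Fin.last d) = max 0 (b + ∑ j, w j * N.eval x j) := by
  refine ⟨.comp N (.layer (Fin.snoc (α := fun _ => Fin d → ℚ) (fun j => Pi.single j 1) w)
    (Fin.snoc (α := fun _ => ℚ) (fun _ => 0) b)), ?_, ?_⟩
  · intro x j
    simp only [FNN.eval, Fin.snoc_castSucc, zero_add]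
    rw [Finset.sum_eq_single j]
    · simp [N.eval_nonneg x j]
    · intro i _ hi; simp [hi]
    · simp
  · intro x
    simp [FNN.eval]

theorem fnn_ex {D : ℕ} (e : Ex D) : ∀ (d : ℕ) (N : FNN D d) (pos : Fin D → Fin d)
    (_ : ∀ x i, N.eval x (pos i) = max 0 (x i)),
    ∃ (d' : ℕ) (N' : FNN D d') (f : Fin d → Fin d') (l : Fin d'),
      (∀ x j, N'.eval x (f j) = N.eval x j) ∧
      ∀ x, N'.eval x l = e.eval (fun i => max 0 (x i)) := by
  induction e with
  | lin b w =>
    intro d N pos hpos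
    obtain ⟨N', h1, h2⟩ := fnn_push N b (fun j => ∑ i, if pos i = j then w i else 0)
    refine ⟨_, N', Fin.castSucc, Fin.last d, h1, fun x => ?_⟩
    rw [h2]
    simp only [Ex.eval, ← hpos, Finset.sum_mul]
    rw [Finset.sum_comm]
    simp
  | sub i e ih =>
    intro d N pos hpos
    obtain ⟨d1, N1, f, l, hf, hl⟩ := ih d N pos hpos
    obtain ⟨N', h1, h2⟩ := fnn_push N1 0
      (fun j => (if j = f (pos i) then 1 else 0) - (if j = l then 1 else 0))
    refine ⟨_, N', fun j => (f j).castSucc, Fin.last _, fun x j => by rw [h1, hf], fun x => ?_⟩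
    rw [h2]
    simp [sub_mul, Finset.sum_sub_distrib, Ex.eval, hf, hl, hpos]
  | conj i e₁ e₂ ih₁ ih₂ =>
    intro d N pos hpos
    obtain ⟨d1, N1, f, l, hf, hl⟩ := ih₁ d N pos hpos
    obtain ⟨d2, N2, g, m, hg, hm⟩ := ih₂ d1 N1 (fun i => f (pos i))
      (fun x i => by rw [hf, hpos])
    obtain ⟨N', h1, h2⟩ := fnn_push N2 0
      (fun j => (if j = g l then 1 else 0) + (if j = m then 1 else 0)
        - (if j = g (f (pos i)) then 1 else 0))
    refine ⟨_, N', fun j => (g (f j)).castSucc, Fin.last _, fun x j => by rw [h1, hg, hf], fun x => ?_⟩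
    rw [h2]
    simp [sub_mul, add_mul, Finset.sum_sub_distrib, Finset.sum_add_distrib, Ex.eval, hf, hl, hg,
      hm, hpos]

theorem fnn_fam {D : ℕ} : ∀ (m : ℕ) (e : Fin m → Ex D),
    ∃ (d : ℕ) (N : FNN D d) (pos : Fin D → Fin d) (q : Fin m → Fin d),
      (∀ x i, N.eval x (pos i) = max 0 (x i)) ∧
      ∀ x j, N.eval x (q j) = (e j).eval (fun i => max 0 (x i)) := by
  intro m
  induction m with
  | zero =>
    intro e
    refine ⟨D, .layer (fun j => Pi.single j 1) (fun _ => 0), id, Fin.elim0, ?_,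
      fun x j => j.elim0⟩
    intro x i
    simp only [FNN.eval, id, zero_add]
    rw [Finset.sum_eq_single i]
    · simp
    · intro j _ hj; simp [hj]
    · simp
  | succ m ih =>
    intro e
    obtain ⟨d, N, pos, q, h1, h2⟩ := ih (fun j => e j.castSucc)
    obtain ⟨d', N', f, l, h3, h4⟩ := fnn_ex (e (Fin.last m)) d N pos h1
    refine ⟨d', N', fun i => f (pos i),
      Fin.snoc (α := fun _ => Fin d') (fun j => f (q j)) l, fun x i => by rw [h3, h1], ?_⟩
    intro x j
    refine Fin.lastCases ?_ (fun j => ?_) j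
    · simp [h4]
    · simp [h3, h2]

theorem fnn_real {D m : ℕ} (e : Fin m → Ex D) :
    ∃ N : FNN D m, ∀ x j, N.eval x j = (e j).eval (fun i => max 0 (x i)) := by
  obtain ⟨d, N, pos, q, _, h2⟩ := fnn_fam m e
  refine ⟨.comp N (.layer (fun j => Pi.single (q j) 1) (fun _ => 0)), fun x j => ?_⟩
  rw [← h2]
  simp only [FNN.eval, zero_add]
  rw [Finset.sum_eq_single (q j)]
  · simp [N.eval_nonneg]
  · intro i _ hi; simp [hi]
  · simp

noncomputable def exLayer {din dout : ℕ} (e : Fin dout → Ex (din + din + din + din)) :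
    MPNNLayer din dout :=
  ⟨(fnn_real e).choose, .mean, .mean, .mean⟩

def own {d : ℕ} (i : Fin d) : Fin (d + d + d + d) :=
  Fin.castAdd d (Fin.castAdd d (Fin.castAdd d i))

def glo {d : ℕ} (i : Fin d) : Fin (d + d + d + d) := Fin.natAdd (d + d + d) i

theorem exLayer_step {k din dout : ℕ} (e : Fin dout → Ex (din + din + din + din))
    (G : Graph k) (x : Fin G.n → Fin din → ℚ) (v : Fin G.n) :
    ∃ y : Fin (din + din + din + din) → ℚ,
      (∀ i, y (own i) = max 0 (x v i)) ∧
      (∀ i, y (glo i) = max 0 ((∑ u, x u i) / (G.n : ℚ))) ∧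
      ∀ j, (exLayer e).step G x v j = (e j).eval y := by
  refine ⟨_, ?_, ?_, fun j => (fnn_real e).choose_spec _ j⟩
  · intro i
    simp only [own, Fin.append_left]
  · intro i
    simp only [glo, Fin.append_right, exLayer, Agg.eval]
    simp only [Finset.sum, Multiset.map_map, Multiset.card_map]
    simp [Function.comp_def]

/-- Propositional evaluation (modal subformulas are read as false). -/
def beval {k : ℕ} (L : Fin k → Bool) : PML k → Bool
  | .prop i => L i
  | .not φ => ! beval L φ
  | .and φ₁ φ₂ => beval L φ₁ && beval L φ₂
  | .modal _ _ _ _ => false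

theorem beval_eq {k : ℕ} (G : Graph k) (v : Fin G.n) (φ : PML k) (h : φ.md = 0) :
    beval (G.L v) φ = PML.sat G φ v := by
  induction φ with
  | prop i => rfl
  | not φ ih => simp only [PML.md] at h; simp [beval, PML.sat, ih h]
  | and φ₁ φ₂ ih₁ ih₂ =>
    simp only [PML.md] at h
    simp [beval, PML.sat, ih₁ (by omega), ih₂ (by omega)]
  | modal m π ψ φs ih => simp only [PML.md] at h; omega

theorem relu_not (ε : ℚ) (hε : 0 ≤ ε) (a : Bool) :
    max 0 (ε - if a = true then ε else 0) = if (!a) = true then ε else 0 := by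
  cases a <;> simp [hε]

theorem relu_and (ε : ℚ) (hε : 0 ≤ ε) (a b : Bool) :
    max 0 ((if a = true then ε else 0) + (if b = true then ε else 0) - ε)
      = if (a && b) = true then ε else 0 := by
  cases a <;> cases b <;> simp [hε]

def bex {k D : ℕ} (c : Fin k → Fin D) (y : Fin D) : PML k → Ex D
  | .prop i => .lin (-1) (fun j => (if j = c i then 1 else 0) + (if j = y then 1 else 0))
  | .not φ => .sub y (bex c y φ)
  | .and φ₁ φ₂ => .conj y (bex c y φ₁) (bex c y φ₂)
  | .modal _ _ _ _ => .lin 0 0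

theorem bex_eval {k D : ℕ} (c : Fin k → Fin D) (y : Fin D) (L : Fin k → Bool)
    (x : Fin D → ℚ) (hc : ∀ i, x (c i) = if L i then 1 else 0) (h0 : 0 ≤ x y) (h1 : x y ≤ 1)
    (φ : PML k) : (bex c y φ).eval x = if beval L φ then x y else 0 := by
  induction φ with
  | prop i =>
    simp only [bex, Ex.eval, add_mul, Finset.sum_add_distrib, beval]
    simp only [ite_mul, one_mul, zero_mul, Finset.sum_ite_eq', Finset.mem_univ, if_true, hc]
    by_cases h : L i = true <;> simp [h, h0, h1]
  | not φ ih =>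
    simp only [bex, Ex.eval, beval, ih]
    exact relu_not _ h0 _
  | and φ₁ φ₂ ih₁ ih₂ =>
    simp only [bex, Ex.eval, beval, ih₁, ih₂]
    exact relu_and _ h0 _ _
  | modal m π ψ φs ih => simp [bex, Ex.eval, beval]

/-- Fraction of nodes satisfying a propositional formula. -/
def frac {k : ℕ} (G : Graph k) (χ : PML k) : ℚ :=
  ((Finset.univ.filter (fun u => beval (G.L u) χ = true)).card : ℚ) / (G.n : ℚ)

theorem frac_nonneg {k : ℕ} (G : Graph k) (χ : PML k) : 0 ≤ frac G χ := by
  unfold frac; positivity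

theorem frac_le_one {k : ℕ} (G : Graph k) (χ : PML k) : frac G χ ≤ 1 := by
  unfold frac
  apply div_le_one_of_le₀
  · exact_mod_cast (Finset.card_le_univ _).trans (by simp)
  · positivity

def mval {k : ℕ} (G : Graph k) (p : Fin k) (l : List (PML k)) (t : ℕ) : ℚ :=
  ∏ s ∈ Finset.range t, frac G (l.getD s (.prop p))

theorem mval_nonneg {k : ℕ} (G : Graph k) (p : Fin k) (l : List (PML k)) (t : ℕ) :
    0 ≤ mval G p l t := Finset.prod_nonneg fun _ _ => frac_nonneg _ _

theorem mval_le_one {k : ℕ} (G : Graph k) (p : Fin k) (l : List (PML k)) (t : ℕ) :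
    mval G p l t ≤ 1 :=
  Finset.prod_le_one (fun _ _ => frac_nonneg _ _) fun _ _ => frac_le_one _ _

theorem frac_prop {k : ℕ} (G : Graph k) (v : Fin G.n) (p : Fin k) (h : G.MarkedBy v p) :
    frac G (.prop p) = 1 / (G.n : ℚ) := by
  unfold frac
  have : (Finset.univ.filter (fun u => beval (G.L u) (.prop p) = true)) = {v} := by
    ext u
    rw [Finset.mem_filter, Finset.mem_singleton, ← h u]
    simp only [Finset.mem_univ, true_and, beval]
  rw [this]; simp

theorem mval_eq {k : ℕ} (G : Graph k) (v : Fin G.n) (p : Fin k) (h : G.MarkedBy v p)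
    (l : List (PML k)) : ∀ d, l.length ≤ d → mval G p l d =
      (l.map (fun χ => ((Finset.univ.filter
        (fun u => beval (G.L u) χ = true)).card : ℚ))).prod / (G.n : ℚ) ^ d := by
  induction l with
  | nil => intro d _; simp [mval, frac_prop G v p h]
  | cons χ l ih =>
    intro d hd
    obtain ⟨d, rfl⟩ : ∃ d', d = d' + 1 := ⟨d - 1, by simp at hd; omega⟩
    have := ih d (by simpa using hd)
    unfold mval at this ⊢
    rw [Finset.prod_range_succ']
    simp only [List.getD_cons_succ, List.getD_cons_zero, List.map_cons, List.prod_cons]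
    rw [this, pow_succ, frac]
    ring

theorem relu_int (ε : ℚ) (hε : 0 ≤ ε) (A : ℤ) :
    max 0 (ε - max 0 ((A : ℚ) * ε)) = if A ≤ 0 then ε else 0 := by
  split_ifs with h
  · have : (A : ℚ) * ε ≤ 0 := mul_nonpos_of_nonpos_of_nonneg (by exact_mod_cast h) hε
    simp [this, hε]
  · have h1 : (1 : ℚ) ≤ A := by exact_mod_cast (by omega : 1 ≤ A)
    have : ε ≤ (A : ℚ) * ε := le_mul_of_one_le_left hε h1
    rw [max_eq_right (hε.trans this)]
    simp [this]

theorem peano_ex {k D m d : ℕ} (p : Fin k) {R : ℕ} (Mon : Fin R → List (PML k))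
    (mpos : Fin R → Fin D) (r0 : Fin R) (h0 : Mon r0 = []) (φs : Fin m → PML k)
    (hmd : ∀ i, (φs i).md = 0) (ψ : PeanoFormula m) (hdeg : ψ.deg ≤ d)
    (hneed : ∀ l ∈ ψ.mons, ∃ r, Mon r = l.map φs) :
    ∃ e : Ex D, ∀ (G : Graph k) (v : Fin G.n), G.MarkedBy v p → ∀ x : Fin D → ℚ,
      (∀ r, x (mpos r) = mval G p (Mon r) d) →
      e.eval x = if ψ.sat (fun i => (Finset.univ.filter
        (fun u => PML.sat G (φs i) u = true)).card) then 1 / (G.n : ℚ) ^ d else 0 := by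
  have heps : ∀ (G : Graph k) (v : Fin G.n), G.MarkedBy v p →
      mval G p (Mon r0) d = 1 / (G.n : ℚ) ^ d := by
    intro G v hv
    rw [mval_eq G v p hv _ d (by simp [h0]), h0]; simp
  induction ψ with
  | ineq t =>
    have hr : ∀ i, ∃ r, Mon r = (t.mon i).map φs := fun i => hneed _ (by simp [PeanoFormula.mons])
    choose r hr using hr
    refine ⟨.sub (mpos r0) (.lin 0 (fun j => (∑ i, if j = mpos (r i) then (t.a i : ℚ) else 0)
      - (if j = mpos r0 then (t.b : ℚ) else 0))), ?_⟩
    intro G v hv x hx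
    have hm : ∀ i, x (mpos (r i)) = (monValZ (fun i => (Finset.univ.filter
        (fun u => PML.sat G (φs i) u = true)).card) (t.mon i) : ℚ) * (1 / (G.n : ℚ) ^ d) := by
      intro i
      have hlen : (t.mon i).length ≤ d :=
        (Finset.le_sup (f := fun i => (t.mon i).length) (Finset.mem_univ i)).trans hdeg
      rw [hx, mval_eq G v p hv _ d (by simpa [hr] using hlen), hr, mul_one_div]
      congr 1
      simp [monValZ, Function.comp_def, beval_eq, hmd]
    have hsum : (0 : ℚ) + ∑ j, ((∑ i, if j = mpos (r i) then (t.a i : ℚ) else 0)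
      - (if j = mpos r0 then (t.b : ℚ) else 0)) * x j =
      (((∑ i, t.a i * monValZ (fun i => (Finset.univ.filter
        (fun u => PML.sat G (φs i) u = true)).card) (t.mon i)) - t.b : ℤ) : ℚ)
        * (1 / (G.n : ℚ) ^ d) := by
      simp only [sub_mul, Finset.sum_sub_distrib, Finset.sum_mul]
      rw [Finset.sum_comm]
      simp only [ite_mul, zero_mul, Finset.sum_ite_eq', Finset.mem_univ, if_true, hm, hx,
        heps G v hv]
      push_cast
      simp only [sub_mul, Finset.sum_mul, mul_assoc, zero_add]
    simp only [Ex.eval]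
    rw [hsum, hx, heps G v hv, relu_int _ (by positivity)]
    simp [PeanoFormula.sat, PeanoIneq.sat]
  | not ψ ih =>
    obtain ⟨e, he⟩ := ih hdeg hneed
    refine ⟨.sub (mpos r0) e, fun G v hv x hx => ?_⟩
    have hp : (0 : ℚ) ≤ 1 / (G.n : ℚ) ^ d := by positivity
    simp only [Ex.eval, he G v hv x hx, hx, heps G v hv, PeanoFormula.sat]
    exact relu_not _ hp _
  | and ψ₁ ψ₂ ih₁ ih₂ =>
    simp only [PeanoFormula.deg] at hdeg
    obtain ⟨e₁, he₁⟩ := ih₁ (by omega) (fun l hl => hneed l (by simp [PeanoFormula.mons, hl]))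
    obtain ⟨e₂, he₂⟩ := ih₂ (by omega) (fun l hl => hneed l (by simp [PeanoFormula.mons, hl]))
    refine ⟨.conj (mpos r0) e₁ e₂, fun G v hv x hx => ?_⟩
    simp only [Ex.eval, he₁ G v hv x hx, he₂ G v hv x hx, hx, heps G v hv, PeanoFormula.sat]
    exact relu_and _ (by positivity) _ _

noncomputable def needed {k : ℕ} : PML k → List (List (PML k))
  | .prop _ => []
  | .not φ => needed φ
  | .and φ₁ φ₂ => needed φ₁ ++ needed φ₂
  | .modal _ _ ψ φs => ψ.mons.toList.map (List.map φs)

theorem final_ex {k D d : ℕ} (p : Fin k) {R : ℕ} (Mon : Fin R → List (PML k))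
    (cpos : Fin k → Fin D) (mpos : Fin R → Fin D) (r0 : Fin R) (h0 : Mon r0 = [])
    (φ : PML k) (hmd : φ.md ≤ 1) (htop : φ.onlyTop) (hdeg : φ.deg ≤ d)
    (hneed : ∀ l ∈ needed φ, ∃ r, Mon r = l) :
    ∃ e : Ex D, ∀ (G : Graph k) (v : Fin G.n), G.MarkedBy v p → ∀ x : Fin D → ℚ,
      (∀ i, x (cpos i) = if G.L v i then 1 else 0) →
      (∀ r, x (mpos r) = mval G p (Mon r) d) →
      e.eval x = if PML.sat G φ v then 1 / (G.n : ℚ) ^ d else 0 := by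
  have heps : ∀ (G : Graph k) (v : Fin G.n), G.MarkedBy v p →
      mval G p (Mon r0) d = 1 / (G.n : ℚ) ^ d := by
    intro G v hv
    rw [mval_eq G v p hv _ d (by simp [h0]), h0]; simp
  induction φ with
  | prop i =>
    refine ⟨bex cpos (mpos r0) (.prop i), fun G v hv x hc hx => ?_⟩
    rw [bex_eval cpos (mpos r0) (G.L v) x hc (by rw [hx]; exact mval_nonneg _ _ _ _)
      (by rw [hx]; exact mval_le_one _ _ _ _), hx, heps G v hv]
    rfl
  | not φ ih =>
    obtain ⟨e, he⟩ := ih hmd htop hdeg hneed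
    refine ⟨.sub (mpos r0) e, fun G v hv x hc hx => ?_⟩
    simp only [Ex.eval, he G v hv x hc hx, hx, heps G v hv, PML.sat]
    exact relu_not _ (by positivity) _
  | and φ₁ φ₂ ih₁ ih₂ =>
    simp only [PML.deg, PML.md] at hdeg hmd
    obtain ⟨e₁, he₁⟩ := ih₁ (by omega) htop.1 (by omega)
      (fun l hl => hneed l (by simp [needed, hl]))
    obtain ⟨e₂, he₂⟩ := ih₂ (by omega) htop.2 (by omega)
      (fun l hl => hneed l (by simp [needed, hl]))
    refine ⟨.conj (mpos r0) e₁ e₂, fun G v hv x hc hx => ?_⟩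
    simp only [Ex.eval, he₁ G v hv x hc hx, he₂ G v hv x hc hx, hx, heps G v hv, PML.sat]
    exact relu_and _ (by positivity) _ _
  | modal m π ψ φs _ =>
    simp only [PML.deg, PML.md] at hdeg hmd
    have hmd' : ∀ i, (φs i).md = 0 := by
      intro i
      have := Finset.le_sup (f := fun i => (φs i).md) (Finset.mem_univ i)
      omega
    obtain ⟨e, he⟩ := peano_ex (D := D) (d := d) p Mon mpos r0 h0 φs hmd' ψ (by omega)
      (fun l hl => hneed _ (by
        simp only [needed, List.mem_map, Finset.mem_toList]; exact ⟨l, hl, rfl⟩))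
    refine ⟨e, fun G v hv x _ hx => ?_⟩
    rw [he G v hv x hx]
    simp only [PML.sat, htop.1, Graph.modSem]

section Net
variable {k R : ℕ}

def colI (i : Fin k) : Fin (k + R + 1) := (Fin.castAdd R i).castSucc
def monI (r : Fin R) : Fin (k + R + 1) := (Fin.natAdd k r).castSucc

def netDims (k R : ℕ) : ℕ → ℕ
  | 0 => k
  | _ + 1 => k + R + 1

def exFirst (k R : ℕ) : Fin (k + R + 1) → Ex (k + k + k + k) :=
  Fin.snoc (α := fun _ => Ex (k + k + k + k))
    (Fin.append (fun i => .lin 0 (fun j => if j = own i then 1 else 0)) (fun _ => .lin 1 0))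
    (.lin 0 0)

abbrev bigD (k R : ℕ) : ℕ := (k + R + 1) + (k + R + 1) + (k + R + 1) + (k + R + 1)

def exNext (p : Fin k) (Mon : Fin R → List (PML k)) (e : Ex (bigD k R)) (t : ℕ) :
    Fin (k + R + 1) → Ex (bigD k R) :=
  Fin.snoc (α := fun _ => Ex (bigD k R))
    (Fin.append (fun i => .lin 0 (fun j => if j = own (colI i) then 1 else 0))
      (fun r => bex (fun i => own (colI i)) (glo (monI r)) ((Mon r).getD t (.prop p))))
    e

noncomputable def net (p : Fin k) (Mon : Fin R → List (PML k)) (e : Ex (bigD k R)) (d : ℕ) :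
    MPNN where
  L := d + 2
  dims := netDims k R
  layers
    | 0 => exLayer (exFirst k R)
    | t + 1 => exLayer (exNext p Mon e t)

theorem net_inv (p : Fin k) (Mon : Fin R → List (PML k)) (e : Ex (bigD k R)) (d : ℕ)
    (G : Graph k) (hn : 0 < G.n) (t : ℕ) :
    (∀ v i, (net p Mon e d).state G (t + 1) v (colI i : Fin (k + R + 1))
      = if G.L v i then 1 else 0) ∧
    (∀ r, (∑ v, (net p Mon e d).state G (t + 1) v (monI r : Fin (k + R + 1))) / (G.n : ℚ)
      = mval G p (Mon r) t) := by
  have hn' : (G.n : ℚ) ≠ 0 := by positivity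
  induction t with
  | zero =>
    have key : ∀ v, ∃ y : Fin (k + k + k + k) → ℚ, (∀ i, y (own i) = max 0 (G.init k v i)) ∧
        ∀ j, (net p Mon e d).state G (0 + 1) v j = (exFirst k R j).eval y := by
      intro v
      obtain ⟨y, h1, _, h3⟩ := exLayer_step (exFirst k R) G (fun v => G.init k v) v
      exact ⟨y, h1, h3⟩
    constructor
    · intro v i
      obtain ⟨y, h1, h3⟩ := key v
      refine (h3 _).trans ?_
      simp only [exFirst, colI, Fin.snoc_castSucc, Fin.append_left, Ex.eval]
      simp only [ite_mul, one_mul, zero_mul, Finset.sum_ite_eq', Finset.mem_univ, if_true, h1,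
        Graph.init]
      cases h : G.L v i <;> simp [h]
    · intro r
      have : ∀ v, (net p Mon e d).state G (0 + 1) v (monI r : Fin (k + R + 1)) = 1 := by
        intro v
        obtain ⟨y, h1, h3⟩ := key v
        refine (h3 _).trans ?_
        rw [exFirst, monI, Fin.snoc_castSucc, Fin.append_right]
        simp [Ex.eval]
      rw [Finset.sum_congr rfl (fun v _ => this v)]
      simp [mval, hn']
  | succ t ih =>
    obtain ⟨ih1, ih2⟩ := ih
    have key : ∀ v, ∃ y : Fin (bigD k R) → ℚ,
        (∀ i, y (own (colI i)) = if G.L v i then 1 else 0) ∧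
        (∀ r, y (glo (monI r)) = mval G p (Mon r) t) ∧
        ∀ j, (net p Mon e d).state G (t + 1 + 1) v j = (exNext p Mon e t j).eval y := by
      intro v
      obtain ⟨y, h1, h2, h3⟩ := exLayer_step (exNext p Mon e t) G
        ((net p Mon e d).state G (t + 1)) v
      refine ⟨y, fun i => ?_, fun r => ?_, h3⟩
      · rw [h1, ih1]; split_ifs <;> simp
      · rw [h2, ih2, max_eq_right (mval_nonneg _ _ _ _)]
    constructor
    · intro v i
      obtain ⟨y, h1, h2, h3⟩ := key v
      refine (h3 _).trans ?_
      rw [colI, exNext, Fin.snoc_castSucc, Fin.append_left, Ex.eval]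
      simp only [ite_mul, one_mul, zero_mul, Finset.sum_ite_eq', Finset.mem_univ, if_true, h1]
      cases h : G.L v i <;> simp
    · intro r
      have : ∀ v, (net p Mon e d).state G (t + 1 + 1) v (monI r : Fin (k + R + 1)) =
          if beval (G.L v) ((Mon r).getD t (.prop p)) = true then mval G p (Mon r) t else 0 := by
        intro v
        obtain ⟨y, h1, h2, h3⟩ := key v
        refine (h3 _).trans ?_
        rw [monI, exNext, Fin.snoc_castSucc, Fin.append_right,
          bex_eval _ _ (G.L v) y h1 (by rw [h2]; exact mval_nonneg _ _ _ _)
          (by rw [h2]; exact mval_le_one _ _ _ _), h2]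
      rw [Finset.sum_congr rfl (fun v _ => this v), ← Finset.sum_filter, Finset.sum_const,
        nsmul_eq_mul, mval, mval, Finset.prod_range_succ, frac]
      ring

theorem net_out (p : Fin k) (Mon : Fin R → List (PML k)) (e : Ex (bigD k R)) (d : ℕ)
    (G : Graph k) (v : Fin G.n) :
    ∃ y : Fin (bigD k R) → ℚ,
        (∀ i, y (own (colI i)) = if G.L v i then 1 else 0) ∧
        (∀ r, y (glo (monI r)) = mval G p (Mon r) d) ∧
        (net p Mon e d).out G v = e.eval y := by
  obtain ⟨ih1, ih2⟩ := net_inv p Mon e d G v.pos d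
  obtain ⟨y, h1, h2, h3⟩ := exLayer_step (exNext p Mon e d) G
        ((net p Mon e d).state G (d + 1)) v
  refine ⟨y, fun i => ?_, fun r => ?_, ?_⟩
  · rw [h1, ih1]; split_ifs <;> simp
  · rw [h2, ih2, max_eq_right (mval_nonneg _ _ _ _)]
  · have hl : (net p Mon e d).out G v =
        (net p Mon e d).state G (d + 1 + 1) v (Fin.last (k + R)) := by
      unfold MPNN.out lastVal
      exact dif_pos (Nat.succ_pos (k + R))
    rw [hl]
    refine (h3 _).trans ?_
    rw [exNext, Fin.snoc_last]

end Net

/-- there is a constant `C` such that every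
`φ ∈ PML₁^⊤` is recognised, over pointed graphs whose focus is marked by
colour `p`, by a mean MPNN with at most `C·(deg(φ)+1)` layers with certainty
`1/|V|^e` for some `e ≤ C·(deg(φ)+1)`. -/
theorem statement2 :
    ∃ C : ℕ, ∀ (k : ℕ) (p : Fin k) (φ : PML k), φ.md ≤ 1 → φ.onlyTop →
      ∃ (M : MPNN) (e : ℕ), M.IsMean ∧ M.dims 0 = k ∧
        M.L ≤ C * (φ.deg + 1) ∧ e ≤ C * (φ.deg + 1) ∧
        Recognises M φ (fun G v => G.MarkedBy v p) (fun n => 1 / (n : ℚ) ^ e) := by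
  refine ⟨2, fun k p φ hmd htop => ?_⟩
  let Ms : List (List (PML k)) := [] :: needed φ
  obtain ⟨e, he⟩ := final_ex (D := bigD k Ms.length) (d := φ.deg) p (fun r => Ms.get r)
    (fun i => own (colI i)) (fun r => glo (monI r)) ⟨0, by simp [Ms]⟩ rfl φ hmd htop le_rfl
    (fun l hl => List.mem_iff_get.1 (List.mem_cons_of_mem _ hl))
  refine ⟨net p (fun r => Ms.get r) e φ.deg, φ.deg, ?_, rfl, ?_, by omega, ?_⟩
  · rintro (_ | i) _ <;> exact ⟨rfl, rfl, rfl⟩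
  · show φ.deg + 2 ≤ _
    omega
  · intro G v hv
    obtain ⟨y, h1, h2, h3⟩ := net_out p (fun r => Ms.get r) e φ.deg G v
    rw [h3, he G v hv y h1 h2]
    constructor <;> intro h <;> simp [h]

end PMLMPNN
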